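/- For every integer n ≥ 3 and every complex n × 2 matrix U with orthonormal columns, there exist indices i ≠ j such that the smallest eigenvalue of the 2 × 2 Hermitian Gram matrix Γ_{ij} = U_{ij} U_{ij}^H is at least α/n, where α = 2 − 2/√3. -/

import Mathlib

open Matrix

open scoped InnerProductSpace

section WeightReduction

variable {ι V : Type*} [Fintype ι] [AddCommGroup V] [Module ℝ V]

/-- Moving nonnegative weights along a nonzero direction of total mass zero supported on their
support, until the first weight vanishes. -/
lemma exists_nonneg_add_mul_card_support_lt {p w : ι → ℝ} (hp : ∀ i, 0 ≤ p i)
    (hsupp : ∀ i, p i = 0 → w i = 0) (hw : w ≠ 0) (hsum : ∑ i, w i = 0) :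
    ∃ t : ℝ, 0 ≤ t ∧ (∀ i, 0 ≤ p i + t * w i) ∧
      (Finset.univ.filter fun i => p i + t * w i ≠ 0).card <
        (Finset.univ.filter fun i => p i ≠ 0).card := by
  classical
  have hne : (Finset.univ.filter fun i => w i < 0).Nonempty := by
    by_contra hcon
    have hnonneg : ∀ i, 0 ≤ w i := by
      intro i
      by_contra hi
      exact hcon ⟨i, by simpa using hi⟩
    apply hw
    funext i
    exact (Finset.sum_eq_zero_iff_of_nonneg fun i _ => hnonneg i).1 hsum i (Finset.mem_univ i)
  obtain ⟨k, hk, hmin⟩ := Finset.exists_min_image _ (fun i => p i / (-w i)) hne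
  have hwk : w k < 0 := by simpa using hk
  have ht : 0 ≤ p k / (-w k) := div_nonneg (hp k) (by linarith)
  refine ⟨p k / (-w k), ht, fun i => ?_, ?_⟩
  · rcases lt_or_ge (w i) 0 with hi | hi
    · have h := hmin i (by simpa using hi)
      rw [le_div_iff₀ (by linarith)] at h
      linarith
    · have := mul_nonneg ht hi
      linarith [hp i]
  · apply Finset.card_lt_card
    rw [Finset.ssubset_iff_of_subset]
    · refine ⟨k, ?_, ?_⟩
      · simpa using fun h => hwk.ne (hsupp k h)
      · have : w k ≠ 0 := hwk.ne
        simp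
        field_simp
        ring
    · intro i hi
      simp only [Finset.mem_filter, Finset.mem_univ, true_and] at hi ⊢
      intro h
      exact hi (by rw [h, hsupp i h]; ring)

/-- A Carathéodory-type reduction: a convex combination can be rewritten with at most
`finrank ℝ V + 1` nonzero weights without decreasing a prescribed linear objective. -/
lemma exists_weights_card_support_le [FiniteDimensional ℝ V] (v : ι → V) (r : ι → ℝ)
    {p : ι → ℝ} (hp : ∀ i, 0 ≤ p i) :
    ∃ q : ι → ℝ, (∀ i, 0 ≤ q i) ∧ ∑ i, q i = ∑ i, p i ∧ ∑ i, q i • v i = ∑ i, p i • v i ∧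
      ∑ i, p i * r i ≤ ∑ i, q i * r i ∧
      (Finset.univ.filter fun i => q i ≠ 0).card ≤ Module.finrank ℝ V + 1 := by
  classical
  induction hm : (Finset.univ.filter fun i => p i ≠ 0).card using Nat.strong_induction_on
    generalizing p with
  | _ m ih =>
  by_cases hle : m ≤ Module.finrank ℝ V + 1
  · exact ⟨p, hp, rfl, rfl, le_rfl, hm ▸ hle⟩
  have hdep : ¬ LinearIndepOn ℝ (fun i => (v i, (1 : ℝ)))
      (↑(Finset.univ.filter fun i => p i ≠ 0) : Set ι) := by
    intro hli
    have h := LinearIndependent.fintype_card_le_finrank hli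
    rw [Module.finrank_prod, Module.finrank_self] at h
    simp only [Finset.coe_sort_coe, Fintype.card_coe] at h
    omega
  rw [not_linearIndepOn_finset_iff] at hdep
  obtain ⟨c, hc, k, hk, hck⟩ := hdep
  obtain ⟨w, hw, hw0, hsum, hv, hr⟩ : ∃ w : ι → ℝ, w ≠ 0 ∧ (∀ i, p i = 0 → w i = 0) ∧
      ∑ i, w i = 0 ∧ ∑ i, w i • v i = 0 ∧ 0 ≤ ∑ i, w i * r i := by
    set w : ι → ℝ := fun i => if p i ≠ 0 then c i else 0 with hwdef
    have hw : w ≠ 0 := fun h => hck (by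
      have := congrFun h k
      simpa [hwdef, (Finset.mem_filter.1 hk).2] using this)
    have hw0 : ∀ i, p i = 0 → w i = 0 := fun i hi => by simp [hwdef, hi]
    have hcw : ∑ i, w i • (v i, (1 : ℝ)) = 0 := by
      rw [← hc, Finset.sum_filter]
      refine Finset.sum_congr rfl fun i _ => ?_
      by_cases hi : p i = 0 <;> simp [hwdef, hi]
    have hv : ∑ i, w i • v i = 0 := by simpa [Prod.fst_sum] using congrArg Prod.fst hcw
    have hsum : ∑ i, w i = 0 := by simpa [Prod.snd_sum] using congrArg Prod.snd hcw
    rcases le_total 0 (∑ i, w i * r i) with h | h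
    · exact ⟨w, hw, hw0, hsum, hv, h⟩
    · exact ⟨-w, neg_ne_zero.2 hw, fun i hi => by simp [hw0 i hi], by simp [hsum],
        by simp [hv], by simpa using h⟩
  obtain ⟨t, ht, hnonneg, hcard⟩ := exists_nonneg_add_mul_card_support_lt hp hw0 hw hsum
  obtain ⟨q, hq, hqsum, hqv, hqr, hqcard⟩ := ih _ (hm ▸ hcard) hnonneg rfl
  refine ⟨q, hq, ?_, ?_, ?_, hqcard⟩
  · rw [hqsum, Finset.sum_add_distrib, ← Finset.mul_sum, hsum, mul_zero, add_zero]
  · simp only [hqv, add_smul, mul_smul, Finset.sum_add_distrib, ← Finset.smul_sum, hv, smul_zero,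
      add_zero]
  · refine le_trans ?_ hqr
    simp only [add_mul, mul_assoc, Finset.sum_add_distrib, ← Finset.mul_sum]
    linarith [mul_nonneg ht hr]

end WeightReduction

section ClosedPolygon

variable {ι V : Type*} [Fintype ι] [NormedAddCommGroup V] [InnerProductSpace ℝ V]

/-- If a vector of weight `p k` in a balanced system of unit mean length makes, with each other
vector `v j`, a defect `‖v k‖ + ‖v j‖ - ‖v k + v j‖` smaller than `2 * (1 - s)`, `s = 1 / √3`,
then its contribution to the mean length is bounded. -/
lemma weight_mul_norm_lt_of_balanced {s : ℝ} (hs : 0 < s) (hs3 : 3 * s ^ 2 = 1) {v : ι → V}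
    {p : ι → ℝ} (hp : ∀ i, 0 ≤ p i) (hsum : ∑ i, p i = 1) (hv : ∑ i, p i • v i = 0)
    (hmean : ∑ i, p i * ‖v i‖ = 1) (k : ι)
    (h : ∀ j, k ≠ j → 2 * (1 - s) ≤ ‖v k‖ + ‖v j‖ →
      ‖v k‖ * ‖v j‖ - 2 * (1 - s) * (‖v k‖ + ‖v j‖) + 2 * (1 - s) ^ 2 < ⟪v k, v j⟫_ℝ) :
    p k * ‖v k‖ < s / 4 + (1 - s) * p k := by
  classical
  have hs1 : s < 1 := by nlinarith
  have hs2 : 1 < 2 * s := by nlinarith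
  rcases le_or_gt ‖v k‖ (1 - s) with hk | hk
  · nlinarith [hp k]
  set b : ι → ℝ := fun j =>
    ‖v k‖ * ‖v j‖ - 2 * (1 - s) * (‖v k‖ + ‖v j‖) + 2 * (1 - s) ^ 2 with hb
  have hlt : ∀ j, k ≠ j → b j < ⟪v k, v j⟫_ℝ := by
    intro j hj
    rcases le_or_gt (2 * (1 - s)) (‖v k‖ + ‖v j‖) with hT | hT
    · exact h j hj hT
    · have h1 := (abs_le.1 (abs_real_inner_le_norm (v k) (v j))).1
      simp only [hb]
      nlinarith
  have hinner : ∑ j, p j * ⟪v k, v j⟫_ℝ = 0 := by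
    have := congrArg (fun x => ⟪v k, x⟫_ℝ) hv
    simpa [inner_sum, real_inner_smul_right] using this
  have hbsum : ∑ j, p j * b j =
      ‖v k‖ - 2 * (1 - s) * (‖v k‖ + 1) + 2 * (1 - s) ^ 2 := by
    have : ∀ j, p j * b j = ‖v k‖ * (p j * ‖v j‖) - 2 * (1 - s) * (‖v k‖ * p j + p j * ‖v j‖)
        + 2 * (1 - s) ^ 2 * p j := fun j => by simp only [hb]; ring
    simp only [this, Finset.sum_add_distrib, Finset.sum_sub_distrib, ← Finset.mul_sum, hsum, hmean]
    ring
  have hrest : 0 < ∑ j ∈ Finset.univ.erase k, p j * (⟪v k, v j⟫_ℝ - b j) := by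
    refine Finset.sum_pos' (fun j hj => mul_nonneg (hp j)
      (sub_nonneg.2 (hlt j (Finset.ne_of_mem_erase hj).symm).le)) ?_
    by_contra! hcon
    have hzero : ∀ j, k ≠ j → p j = 0 := by
      intro j hj
      have h1 := hcon j (Finset.mem_erase.2 ⟨hj.symm, Finset.mem_univ j⟩)
      have h2 := hlt j hj
      nlinarith [hp j]
    have hpk : p k = 1 := by
      rw [← hsum, Finset.sum_eq_single k (fun j _ hj => hzero j hj.symm) (by simp)]
    have hvk : v k = 0 := by
      rw [Finset.sum_eq_single k (fun j _ hj => by rw [hzero j hj.symm, zero_smul]) (by simp),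
        hpk, one_smul] at hv
      exact hv
    rw [hvk, norm_zero] at hk
    linarith
  have hall : ∑ j, p j * (⟪v k, v j⟫_ℝ - b j) =
      -(‖v k‖ - 2 * (1 - s) * (‖v k‖ + 1) + 2 * (1 - s) ^ 2) := by
    simp only [mul_sub, Finset.sum_sub_distrib, hinner, hbsum]
    ring
  rw [← Finset.add_sum_erase _ _ (Finset.mem_univ k), real_inner_self_eq_norm_sq] at hall
  simp only [hb] at hall
  have hD : 0 < (2 * s - 1) + 4 * (1 - s) * p k := by nlinarith [hp k]
  have hkey : ((2 * s - 1) + 4 * (1 - s) * p k) * ‖v k‖ < 2 * (1 - s) * (s + (1 - s) * p k) := by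
    nlinarith
  have hfin : p k * (2 * (1 - s) * (s + (1 - s) * p k)) ≤
      (s / 4 + (1 - s) * p k) * ((2 * s - 1) + 4 * (1 - s) * p k) := by
    have : (s / 4 + (1 - s) * p k) * ((2 * s - 1) + 4 * (1 - s) * p k)
        - p k * (2 * (1 - s) * (s + (1 - s) * p k)) = 2 * (1 - s) ^ 2 * (p k - 1 / 4) ^ 2 := by
      linear_combination (1/8 : ℝ) * hs3
    have : 0 ≤ 2 * (1 - s) ^ 2 * (p k - 1 / 4) ^ 2 := by positivity
    linarith
  rcases (hp k).eq_or_lt with h0 | h0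
  · rw [← h0]; linarith
  · nlinarith [mul_lt_mul_of_pos_left hkey h0]

/-- A closed polygon in dimension at most three has two sides for which
`‖v i‖ + ‖v j‖ - ‖v i + v j‖` is at least `2 - 2 / √3` times the mean side length. The bound is
written without the norm of the sum. -/
theorem exists_pair_inner_le_of_sum_eq_zero [FiniteDimensional ℝ V]
    (hdim : Module.finrank ℝ V ≤ 3) {s : ℝ} (hs : 0 < s) (hs3 : 3 * s ^ 2 = 1) {v : ι → V}
    (hv : ∑ i, v i = 0) {τ : ℝ} (hτ : (1 - s) * ∑ i, ‖v i‖ = Fintype.card ι * τ)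
    (hpos : 0 < ∑ i, ‖v i‖) :
    ∃ i j, i ≠ j ∧ 2 * τ ≤ ‖v i‖ + ‖v j‖ ∧
      ⟪v i, v j⟫_ℝ ≤ ‖v i‖ * ‖v j‖ - 2 * τ * (‖v i‖ + ‖v j‖) + 2 * τ ^ 2 := by
  classical
  by_contra! hcon
  have hs1 : s < 1 := by nlinarith
  have hne : Nonempty ι := by
    by_contra hempty
    rw [not_nonempty_iff] at hempty
    simp at hpos
  have hN : (0 : ℝ) < Fintype.card ι := by exact_mod_cast Fintype.card_pos
  obtain ⟨q, hq, hqsum, hqv, hqr, hcard⟩ := exists_weights_card_support_le v (fun i => ‖v i‖)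
    (p := fun _ => (Fintype.card ι : ℝ)⁻¹) (fun _ => by positivity)
  rw [← Finset.smul_sum, hv, smul_zero] at hqv
  rw [← Finset.mul_sum] at hqr
  replace hqsum : ∑ i, q i = 1 := by rw [hqsum]; simp
  set R := ∑ i, q i * ‖v i‖ with hR
  have hRpos : 0 < R := lt_of_lt_of_le (by positivity) hqr
  have hτR : τ ≤ (1 - s) * R := by
    have : τ = (1 - s) * ((Fintype.card ι : ℝ)⁻¹ * ∑ i, ‖v i‖) := by
      field_simp
      linarith
    rw [this]
    exact mul_le_mul_of_nonneg_left hqr (by linarith)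
  have hnorm : ∀ i, ‖R⁻¹ • v i‖ = R⁻¹ * ‖v i‖ := fun i => by
    rw [norm_smul, Real.norm_of_nonneg (by positivity)]
  have hbound : ∀ k, q k * (R⁻¹ * ‖v k‖) < s / 4 + (1 - s) * q k := by
    intro k
    rw [← hnorm]
    refine weight_mul_norm_lt_of_balanced (v := fun i => R⁻¹ • v i) hs hs3 hq hqsum ?_ ?_ k ?_
    · simp only [smul_comm _ R⁻¹, ← Finset.smul_sum, hqv, smul_zero]
    · simp only [hnorm, mul_left_comm _ R⁻¹, ← Finset.mul_sum]
      exact inv_mul_cancel₀ hRpos.ne'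
    · intro j hj
      simp only [hnorm, real_inner_smul_left, real_inner_smul_right]
      intro hT
      have hT' : 2 * ((1 - s) * R) ≤ ‖v k‖ + ‖v j‖ := by
        rw [← mul_add, inv_mul_eq_div, le_div_iff₀ hRpos] at hT
        linarith
      have h1 := hcon k j hj (by linarith)
      have h2 : ‖v k‖ * ‖v j‖ - 2 * ((1 - s) * R) * (‖v k‖ + ‖v j‖) + 2 * ((1 - s) * R) ^ 2
          < ⟪v k, v j⟫_ℝ := by
        nlinarith [mul_nonneg (sub_nonneg.2 hτR)
          (by linarith : 0 ≤ ‖v k‖ + ‖v j‖ - (1 - s) * R - τ)]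
      have h3 := mul_lt_mul_of_pos_left h2 (by positivity : 0 < R⁻¹ * R⁻¹)
      refine lt_of_eq_of_lt ?_ (h3.trans_eq (mul_assoc _ _ _))
      field_simp
  have hone : ∑ i ∈ Finset.univ.filter (fun i => q i ≠ 0), q i * (R⁻¹ * ‖v i‖) = 1 := by
    rw [Finset.sum_filter_of_ne (fun i _ h => left_ne_zero_of_mul h)]
    simp only [mul_left_comm _ R⁻¹, ← Finset.mul_sum]
    exact inv_mul_cancel₀ hRpos.ne'
  have hqsupp : ∑ i ∈ Finset.univ.filter (fun i => q i ≠ 0), q i = 1 := by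
    rw [Finset.sum_filter_ne_zero, hqsum]
  have hnonempty : (Finset.univ.filter fun i => q i ≠ 0).Nonempty := by
    rw [Finset.nonempty_iff_ne_empty]
    intro h
    simp [h] at hqsupp
  have hlt := Finset.sum_lt_sum_of_nonempty hnonempty fun i _ => hbound i
  rw [hone, Finset.sum_add_distrib, ← Finset.mul_sum, hqsupp, Finset.sum_const, nsmul_eq_mul]
    at hlt
  have hcard4 : ((Finset.univ.filter fun i => q i ≠ 0).card : ℝ) ≤ 4 := by
    exact_mod_cast hcard.trans (by omega)
  nlinarith

end ClosedPolygon

/-- A criterion for a lower bound on the eigenvalues of a `2 × 2` Hermitian matrix. -/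
lemma Matrix.IsHermitian.le_eigenvalues_fin_two {A : Matrix (Fin 2) (Fin 2) ℂ}
    (hA : A.IsHermitian) {τ T d : ℝ} (htr : A.trace = T) (hdet : A.det = d)
    (hT : 2 * τ ≤ T) (hd : 0 ≤ d - τ * T + τ ^ 2) (k : Fin 2) : τ ≤ hA.eigenvalues k := by
  have h1 := hA.trace_eq_sum_eigenvalues
  have h2 := hA.det_eq_prod_eigenvalues
  rw [htr, Fin.sum_univ_two] at h1
  rw [hdet, Fin.prod_univ_two] at h2
  replace h1 : T = hA.eigenvalues 0 + hA.eigenvalues 1 := by simpa using congrArg Complex.re h1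
  replace h2 : d = hA.eigenvalues 0 * hA.eigenvalues 1 := by simpa using congrArg Complex.re h2
  subst h1 h2
  fin_cases k <;> simp only [Fin.zero_eta, Fin.mk_one] <;> by_contra! hk <;> nlinarith

/-- The Bloch vector of `(a, b) ∈ ℂ²`. -/
noncomputable def blochVector (a b : ℂ) : EuclideanSpace ℝ (Fin 3) :=
  !₂[Complex.normSq a - Complex.normSq b, 2 * (a * star b).re, 2 * (a * star b).im]

lemma norm_blochVector (a b : ℂ) :
    ‖blochVector a b‖ = Complex.normSq a + Complex.normSq b := by
  rw [EuclideanSpace.norm_eq, Real.sqrt_eq_iff_eq_sq (by positivity)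
    (add_nonneg (Complex.normSq_nonneg a) (Complex.normSq_nonneg b))]
  simp [blochVector, Fin.sum_univ_three, Complex.normSq_apply]
  ring

lemma sum_blochVector_eq_zero {ι : Type*} [Fintype ι] {a b : ι → ℂ}
    (heq : ∑ i, Complex.normSq (a i) = ∑ i, Complex.normSq (b i))
    (horth : ∑ i, a i * star (b i) = 0) : ∑ i, blochVector (a i) (b i) = 0 := by
  have hre := congrArg Complex.re horth
  have him := congrArg Complex.im horth
  rw [Complex.re_sum, Complex.zero_re] at hre
  rw [Complex.im_sum, Complex.zero_im] at him
  ext l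
  fin_cases l
  · simp [blochVector, heq]
  · simpa [blochVector, ← Finset.mul_sum] using hre
  · simpa [blochVector, ← Finset.mul_sum] using him

lemma inner_blochVector (a b c d : ℂ) :
    ⟪blochVector a b, blochVector c d⟫_ℝ =
      ‖blochVector a b‖ * ‖blochVector c d‖ - 2 * Complex.normSq (a * d - b * c) := by
  rw [norm_blochVector, norm_blochVector]
  simp [blochVector, PiLp.inner_apply, Fin.sum_univ_three, Complex.normSq_apply]
  ring

/-- For every integer `n ≥ 3` and every complex `n × 2` matrix `U` with
orthonormal columns, there exist indices `i ≠ j` such that the smallest eigenvalue of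
the `2 × 2` Hermitian Gram matrix `Γ = U_{ij} * U_{ij}ᴴ` is at least `α / n`,
where `α = 2 - 2/√3`. -/
theorem exists_submatrix_gram_smallest_eigenvalue_ge
    (n : ℕ) (hn : 3 ≤ n) (U : Matrix (Fin n) (Fin 2) ℂ) (hU : Uᴴ * U = 1) :
    ∃ i j : Fin n, i ≠ j ∧ ∀ k : Fin 2,
      (2 - 2 / Real.sqrt 3) / n ≤
        (Matrix.isHermitian_mul_conjTranspose_self (U.submatrix ![i, j] id)).eigenvalues k := by
  have hcol : ∀ l, ∑ i, Complex.normSq (U i l) = 1 := by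
    intro l
    have h := congrFun (congrFun hU l) l
    simp only [mul_apply, conjTranspose_apply, one_apply_eq, Complex.star_def,
      ← Complex.normSq_eq_conj_mul_self] at h
    exact_mod_cast h
  have horth : ∑ i, U i 0 * star (U i 1) = 0 := by
    have h := congrFun (congrFun hU 1) 0
    simpa [mul_apply, mul_comm] using h
  have hlen : ∑ i, ‖blochVector (U i 0) (U i 1)‖ = 2 := by
    simp only [norm_blochVector, Finset.sum_add_distrib, hcol]
    norm_num
  have hn0 : (n : ℝ) ≠ 0 := by positivity
  obtain ⟨i, j, hij, hT, hG⟩ := exists_pair_inner_le_of_sum_eq_zero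
    (v := fun i => blochVector (U i 0) (U i 1)) (s := (Real.sqrt 3)⁻¹)
    (τ := (2 - 2 / Real.sqrt 3) / n) (by simp) (by positivity) (by simp)
    (sum_blochVector_eq_zero ((hcol 0).trans (hcol 1).symm) horth)
    (by rw [hlen, Fintype.card_fin]; field_simp) (by rw [hlen]; norm_num)
  refine ⟨i, j, hij, Matrix.IsHermitian.le_eigenvalues_fin_two _
    (T := ‖blochVector (U i 0) (U i 1)‖ + ‖blochVector (U j 0) (U j 1)‖)
    (d := Complex.normSq (U i 0 * U j 1 - U i 1 * U j 0)) ?_ ?_ hT ?_⟩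
  · simp only [norm_blochVector, trace_fin_two, mul_apply, Fin.sum_univ_two, conjTranspose_apply,
      submatrix_apply, Complex.star_def, Complex.mul_conj]
    simp
  · rw [det_mul, det_conjTranspose, Complex.star_def, Complex.mul_conj, det_fin_two]
    simp
  · rw [inner_blochVector] at hG
    linarith
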